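/- arXiv:1807.03074 — 10 statements merged into one kernel-verified Lean document; each statement's English description precedes it below -/
import Mathlib

section
/- Let A be a real m×n matrix and let H be a real n×m matrix satisfying AHA = A (property P1) and (AH)ᵀ = AH (property P3). Then for every b ∈ ℝ^m, the vector x := Hb minimizes ‖Ax − b‖₂ over all x ∈ ℝ^n. -/
open Matrix

/-- If `A * H * A = A` and `A * H` is symmetric, the residual `A H b - b` is orthogonal to the
range of `A`. -/
theorem Matrix.mulVec_dotProduct_residual_eq_zero {ι κ R : Type*} [Fintype ι] [Fintype κ]
    [CommRing R] {A : Matrix ι κ R} {H : Matrix κ ι R}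
    (hP1 : A * H * A = A) (hP3 : (A * H)ᵀ = A * H) (b : ι → R) (d : κ → R) :
    (A *ᵥ d) ⬝ᵥ (A *ᵥ (H *ᵥ b) - b) = 0 := by
  have h : Aᵀ * (A * H) = Aᵀ := by
    rw [← hP3, ← transpose_mul, hP1]
  rw [← vecMul_transpose, ← dotProduct_mulVec, mulVec_sub, mulVec_mulVec, mulVec_mulVec,
    Matrix.mul_assoc, h, sub_self, dotProduct_zero]

/-- P1 + P3 imply that `H b` solves the least-squares problem
`min ‖A x - b‖₂` over `x`. -/
theorem stmt_0 (m n : ℕ) (A : Matrix (Fin m) (Fin n) ℝ)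
    (H : Matrix (Fin n) (Fin m) ℝ)
    (hP1 : A * H * A = A) (hP3 : (A * H)ᵀ = A * H) :
    ∀ b : Fin m → ℝ, ∀ x : Fin n → ℝ,
      Real.sqrt (∑ i, (A.mulVec (H.mulVec b) i - b i) ^ 2) ≤
        Real.sqrt (∑ i, (A.mulVec x i - b i) ^ 2) := by
  intro b x
  apply Real.sqrt_le_sqrt
  have h := mulVec_dotProduct_residual_eq_zero hP1 hP3 b (x - H *ᵥ b)
  rw [mulVec_sub] at h
  simp only [dotProduct, Pi.sub_apply] at h
  calc ∑ i, ((A *ᵥ (H *ᵥ b)) i - b i) ^ 2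
      = ∑ i, ((A *ᵥ (H *ᵥ b)) i - b i) ^ 2 +
          2 * ∑ i, ((A *ᵥ x) i - (A *ᵥ (H *ᵥ b)) i) * ((A *ᵥ (H *ᵥ b)) i - b i) := by
        rw [h, mul_zero, add_zero]
    _ = ∑ i, (((A *ᵥ (H *ᵥ b)) i - b i) ^ 2 +
          2 * (((A *ᵥ x) i - (A *ᵥ (H *ᵥ b)) i) * ((A *ᵥ (H *ᵥ b)) i - b i))) := by
        rw [Finset.mul_sum, Finset.sum_add_distrib]
    _ ≤ ∑ i, ((A *ᵥ x) i - b i) ^ 2 := by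
        refine Finset.sum_le_sum fun i _ => ?_
        linarith [sq_nonneg ((A *ᵥ x) i - (A *ᵥ (H *ᵥ b)) i)]
end

section
/- Let A be a real m×n matrix and let H be a real n×m matrix satisfying AHA = A (property P1) and (HA)ᵀ = HA (property P4). Then for every b ∈ ℝ^m lying in the column space of A, the vector Hb solves min{‖x‖₂ : Ax = b, x ∈ ℝ^n}; that is, A(Hb) = b and ‖Hb‖₂ ≤ ‖x‖₂ for every x with Ax = b. -/
open Matrix

/-- P1 + P4 imply that for `b` in the column space of `A`, `H b` solves
`min ‖x‖₂ subject to A x = b`. -/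
theorem stmt_1 (m n : ℕ) (A : Matrix (Fin m) (Fin n) ℝ)
    (H : Matrix (Fin n) (Fin m) ℝ)
    (hP1 : A * H * A = A) (hP4 : (H * A)ᵀ = H * A) :
    ∀ b : Fin m → ℝ, (∃ x₀ : Fin n → ℝ, A.mulVec x₀ = b) →
      A.mulVec (H.mulVec b) = b ∧
      ∀ x : Fin n → ℝ, A.mulVec x = b →
        Real.sqrt (∑ i, (H.mulVec b i) ^ 2) ≤ Real.sqrt (∑ i, (x i) ^ 2) := by
  rintro b ⟨x₀, rfl⟩
  refine ⟨by simp only [mulVec_mulVec, ← Matrix.mul_assoc, hP1], fun x hx => ?_⟩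
  rw [← hx, mulVec_mulVec]
  apply Real.sqrt_le_sqrt
  have hidem : (H * A) * (H * A) = H * A := by
    rw [Matrix.mul_assoc, ← Matrix.mul_assoc A, hP1]
  have hdot : (H * A) *ᵥ x ⬝ᵥ (H * A) *ᵥ x = x ⬝ᵥ (H * A) *ᵥ x := by
    nth_rewrite 1 [← hP4]
    rw [mulVec_transpose, ← dotProduct_mulVec, mulVec_mulVec, hidem]
  generalize (H * A) *ᵥ x = y at hdot ⊢
  have hsq : 0 ≤ ∑ i, (x i - y i) ^ 2 := Finset.sum_nonneg fun i _ => sq_nonneg _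
  have hexpand : ∑ i, (x i - y i) ^ 2 = ∑ i, x i ^ 2 - 2 * (x ⬝ᵥ y) + y ⬝ᵥ y := by
    simp only [dotProduct, Finset.mul_sum, ← Finset.sum_sub_distrib, ← Finset.sum_add_distrib]
    exact Finset.sum_congr rfl fun i _ => by ring
  have hy : ∑ i, y i ^ 2 = y ⬝ᵥ y := by simp only [dotProduct, sq]
  linarith
end

section
/- Let H be a generalized inverse of a real m×n matrix A (i.e., AHA = A). Then H additionally satisfies HAH = H (i.e., H is a reflexive generalized inverse of A) if and only if rank(H) = rank(A). -/
open Matrix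

/-- If `A * H * A = A`, then `rank A ≤ rank H`. -/
theorem rank_le_rank_of_mul_mul_eq {m n : ℕ} {A : Matrix (Fin m) (Fin n) ℝ}
    {H : Matrix (Fin n) (Fin m) ℝ} (h : A * H * A = A) : A.rank ≤ H.rank :=
  calc A.rank = (A * H * A).rank := by rw [h]
    _ ≤ (A * H).rank := rank_mul_le_left _ _
    _ ≤ H.rank := rank_mul_le_right _ _

/-- A generalized inverse `H` of `A` is reflexive (`H A H = H`)
iff `rank H = rank A`. -/
theorem stmt_3 (m n : ℕ) (A : Matrix (Fin m) (Fin n) ℝ)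
    (H : Matrix (Fin n) (Fin m) ℝ)
    (hP1 : A * H * A = A) :
    H * A * H = H ↔ H.rank = A.rank := by
  refine ⟨fun h => (rank_le_rank_of_mul_mul_eq h).antisymm (rank_le_rank_of_mul_mul_eq hP1),
    fun h => ?_⟩
  have hrange : (H * A).mulVecLin.range = H.mulVecLin.range := by
    apply Submodule.eq_of_le_of_finrank_le
    · rw [mulVecLin_mul]
      exact LinearMap.range_comp_le_range _ _
    · calc H.rank = A.rank := h
        _ = (A * (H * A)).rank := by rw [← Matrix.mul_assoc, hP1]
        _ ≤ (H * A).rank := rank_mul_le_right _ _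
  refine Matrix.ext_of_mulVec_single fun i => ?_
  obtain ⟨y, hy⟩ : H *ᵥ Pi.single i 1 ∈ (H * A).mulVecLin.range :=
    hrange ▸ LinearMap.mem_range_self H.mulVecLin _
  rw [mulVecLin_apply] at hy
  rw [← mulVec_mulVec, ← hy, mulVec_mulVec, Matrix.mul_assoc, ← Matrix.mul_assoc A, hP1]
end

section
/- Let r ∈ ℝ^m and s ∈ ℝ^n be nonzero vectors and let A := r sᵀ (an m×n rank-1 matrix). Fix indices j ∈ {1,…,m} and i ∈ {1,…,n} with r_j s_i ≠ 0, and define the n×m matrix H := (1/(r_j s_i)) e_i e_jᵀ, where e_i ∈ ℝ^n and e_j ∈ ℝ^m are standard unit vectors. Then H is a reflexive generalized inverse of A, i.e., AHA = A and HAH = H. -/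
open Matrix

/-- For a rank-1 matrix `A = r sᵀ` and indices `j, i` with `r j * s i ≠ 0`,
the matrix `H = (1 / (r j * s i)) eᵢ eⱼᵀ` is a reflexive generalized
inverse of `A`. -/
theorem stmt_6 (m n : ℕ) (r : Fin m → ℝ) (s : Fin n → ℝ)
    (hr : r ≠ 0) (hs : s ≠ 0)
    (A : Matrix (Fin m) (Fin n) ℝ) (hA : A = vecMulVec r s)
    (j : Fin m) (i : Fin n) (hji : r j * s i ≠ 0)
    (H : Matrix (Fin n) (Fin m) ℝ)
    (hH : H = (1 / (r j * s i)) •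
      vecMulVec (Pi.single i 1 : Fin n → ℝ) (Pi.single j 1 : Fin m → ℝ)) :
    A * H * A = A ∧ H * A * H = H := by
  subst hA hH
  obtain ⟨hj, hi⟩ := mul_ne_zero_iff.mp hji
  constructor
  · simp only [Matrix.mul_smul, Matrix.smul_mul, vecMulVec_mul_vecMulVec, vecMulVec_smul,
      smul_smul, dotProduct_single, single_dotProduct, one_mul, mul_one]
    field_simp
    rw [one_smul]
  · simp only [Matrix.mul_smul, Matrix.smul_mul, vecMulVec_mul_vecMulVec, vecMulVec_smul,
      smul_smul, dotProduct_single, single_dotProduct, one_mul, mul_one]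
    field_simp
end

section
/- Let r ∈ ℝ^m and s ∈ ℝ^n be nonzero vectors and let A := r sᵀ. Then every generalized inverse H' of A (i.e., every n×m matrix with A H' A = A) satisfies ‖H'‖₁ ≥ 1/(‖r‖_∞ ‖s‖_∞), where ‖r‖_∞ = max_j |r_j| and ‖s‖_∞ = max_i |s_i|. -/
open Matrix

/-- A generalized inverse `H` of a nonzero outer product `r sᵀ` satisfies `sᵀ H r = 1`. -/
theorem sum_mul_mul_eq_one_of_vecMulVec_mul_mul {m n : Type*} [Fintype m] [Fintype n]
    {r : m → ℝ} {s : n → ℝ} (hr : r ≠ 0) (hs : s ≠ 0) {H : Matrix n m ℝ}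
    (h : vecMulVec r s * H * vecMulVec r s = vecMulVec r s) :
    ∑ i, ∑ j, s i * H i j * r j = 1 := by
  obtain ⟨j₀, hj⟩ := Function.ne_iff.mp hr
  obtain ⟨i₀, hi⟩ := Function.ne_iff.mp hs
  have h₀ := congrFun (congrFun h j₀) i₀
  simp only [mul_apply, vecMulVec_apply, Finset.sum_mul] at h₀
  rw [Finset.sum_comm] at h₀
  have hne : r j₀ * s i₀ ≠ 0 := mul_ne_zero hj hi
  refine mul_left_cancel₀ hne ?_
  rw [mul_one]
  refine Eq.trans ?_ h₀
  rw [Finset.mul_sum]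
  refine Finset.sum_congr rfl fun i _ => ?_
  rw [Finset.mul_sum]
  exact Finset.sum_congr rfl fun j _ => by ring

/-- The bilinear form `sᵀ H r` is at most `‖r‖_∞ ‖s‖_∞ ‖H‖₁`. -/
theorem sum_mul_mul_le_iSup_abs_mul {m n : Type*} [Fintype m] [Fintype n]
    (r : m → ℝ) (s : n → ℝ) (H : Matrix n m ℝ) :
    ∑ i, ∑ j, s i * H i j * r j ≤
      (∑ i, ∑ j, |H i j|) * ((⨆ j, |r j|) * (⨆ i, |s i|)) := by
  simp only [Finset.sum_mul]
  refine Finset.sum_le_sum fun i _ => Finset.sum_le_sum fun j _ => ?_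
  have hrj : |r j| ≤ ⨆ j, |r j| := le_ciSup (Set.finite_range fun j => |r j|).bddAbove j
  have hsi : |s i| ≤ ⨆ i, |s i| := le_ciSup (Set.finite_range fun i => |s i|).bddAbove i
  calc s i * H i j * r j ≤ |s i * H i j * r j| := le_abs_self _
    _ = |H i j| * (|r j| * |s i|) := by rw [abs_mul, abs_mul]; ring
    _ ≤ _ := by
      have := (abs_nonneg (r j)).trans hrj
      gcongr

/-- Every generalized inverse `H'` of the rank-1 matrix `A = r sᵀ` satisfies
`‖H'‖₁ ≥ 1 / (‖r‖_∞ ‖s‖_∞)`. -/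
theorem stmt_8 (m n : ℕ) (r : Fin m → ℝ) (s : Fin n → ℝ)
    (hr : r ≠ 0) (hs : s ≠ 0)
    (A : Matrix (Fin m) (Fin n) ℝ) (hA : A = vecMulVec r s) :
    ∀ H' : Matrix (Fin n) (Fin m) ℝ, A * H' * A = A →
      1 / ((⨆ j, |r j|) * (⨆ i, |s i|)) ≤ ∑ i, ∑ j, |H' i j| := by
  intro H' h
  subst hA
  have hone := sum_mul_mul_eq_one_of_vecMulVec_mul_mul hr hs h
  refine div_le_of_le_mul₀ ?_ ?_ (hone ▸ sum_mul_mul_le_iSup_abs_mul r s H')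
  · exact mul_nonneg (Real.iSup_nonneg fun _ => abs_nonneg _)
      (Real.iSup_nonneg fun _ => abs_nonneg _)
  · exact Finset.sum_nonneg fun _ _ => Finset.sum_nonneg fun _ _ => abs_nonneg _
end

section
/- Let A be a real rank-1 matrix. Then the minimum of ‖H‖₁ over all generalized inverses H of A (matrices with AHA = A) is attained by a matrix that is also a reflexive generalized inverse of A (i.e., also satisfies HAH = H); in particular, min{‖H‖₁ : AHA = A} = min{‖H‖₁ : AHA = A and HAH = H}. -/
open Matrix

/-- A real matrix of rank one is an outer product of two vectors. -/
theorem exists_eq_vecMulVec_of_rank_eq_one {m n : ℕ} (A : Matrix (Fin m) (Fin n) ℝ)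
    (hrank : A.rank = 1) :
    ∃ (u : Fin m → ℝ) (v : Fin n → ℝ), A = vecMulVec u v := by
  obtain ⟨u, -, hu⟩ := finrank_eq_one_iff'.1 hrank
  choose v hv using fun j => hu ⟨A.mulVecLin (Pi.single j 1), LinearMap.mem_range_self _ _⟩
  refine ⟨u.1, v, ?_⟩
  ext i j
  have h := congrFun (congrArg Subtype.val (hv j)) i
  simp only [SetLike.val_smul, Pi.smul_apply, smul_eq_mul, mulVecLin_apply, mulVec_single_one,
    col_apply] at h
  rw [vecMulVec_apply, ← h, mul_comm]

theorem vecMulVec_mul_mul_vecMulVec {m n : ℕ} (u : Fin m → ℝ) (v : Fin n → ℝ)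
    (H : Matrix (Fin n) (Fin m) ℝ) :
    vecMulVec u v * H * vecMulVec u v = (v ⬝ᵥ H *ᵥ u) • vecMulVec u v := by
  rw [Matrix.mul_assoc, mul_vecMulVec, vecMulVec_mul_vecMulVec, vecMulVec_smul]

/-- The bilinear form of a matrix is bounded by its entrywise 1-norm times a bound on the
products of the entries of the vectors. -/
theorem dotProduct_mulVec_le {m n : ℕ} (u : Fin m → ℝ) (v : Fin n → ℝ)
    (H : Matrix (Fin n) (Fin m) ℝ) {c : ℝ} (hc : ∀ i j, |v i * u j| ≤ c) :
    v ⬝ᵥ H *ᵥ u ≤ c * ∑ i, ∑ j, |H i j| := by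
  simp only [dotProduct, mulVec, Finset.mul_sum]
  refine Finset.sum_le_sum fun i _ => Finset.sum_le_sum fun j _ => ?_
  calc v i * (H i j * u j) = (v i * u j) * H i j := by ring
    _ ≤ |(v i * u j) * H i j| := le_abs_self _
    _ = |v i * u j| * |H i j| := abs_mul _ _
    _ ≤ c * |H i j| := mul_le_mul_of_nonneg_right (hc i j) (abs_nonneg _)

/-- For a rank-1 real matrix `A`, the minimum entrywise 1-norm over all
generalized inverses of `A` is attained by a reflexive generalized
inverse; in particular
`min {‖H‖₁ : AHA = A} = min {‖H‖₁ : AHA = A, HAH = H}`. -/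
theorem stmt_9 (m n : ℕ) (A : Matrix (Fin m) (Fin n) ℝ) (hrank : A.rank = 1) :
    ∃ H : Matrix (Fin n) (Fin m) ℝ,
      A * H * A = A ∧ H * A * H = H ∧
      ∀ H' : Matrix (Fin n) (Fin m) ℝ, A * H' * A = A →
        ∑ i, ∑ j, |H i j| ≤ ∑ i, ∑ j, |H' i j| := by
  have hA : A ≠ 0 := by
    rintro rfl
    simp at hrank
  obtain ⟨u, v, rfl⟩ := exists_eq_vecMulVec_of_rank_eq_one A hrank
  obtain ⟨i₀, j₀, h₀⟩ : ∃ i j, v i * u j ≠ 0 := by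
    by_contra! h
    exact hA (by ext j i; simpa [vecMulVec_apply, mul_comm] using h i j)
  have : Nonempty (Fin n × Fin m) := ⟨(i₀, j₀)⟩
  obtain ⟨⟨q, p⟩, hmax⟩ := Finite.exists_max fun x : Fin n × Fin m => |v x.1 * u x.2|
  have hpos : 0 < |v q * u p| := (abs_pos.2 h₀).trans_le (hmax (i₀, j₀))
  have hne : v q * u p ≠ 0 := abs_pos.1 hpos
  refine ⟨Matrix.single q p (v q * u p)⁻¹, ?_, ?_, fun H' hH' => ?_⟩
  · have h : v ⬝ᵥ Matrix.single q p (v q * u p)⁻¹ *ᵥ u = 1 := by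
      rw [single_mulVec, ← Pi.single, dotProduct_single, mul_left_comm, inv_mul_cancel₀ hne]
    rw [vecMulVec_mul_mul_vecMulVec, h, one_smul]
  · rw [single_mul_mul_single, vecMulVec_apply]
    congr 1
    field_simp
  · have h : v ⬝ᵥ H' *ᵥ u = 1 := by
      rw [vecMulVec_mul_mul_vecMulVec] at hH'
      exact smul_left_injective ℝ hA (hH'.trans (one_smul ℝ _).symm)
    have hle := dotProduct_mulVec_le u v H' fun i j => hmax (i, j)
    have hsum : ∑ i, ∑ j, |Matrix.single q p (v q * u p)⁻¹ i j| = |v q * u p|⁻¹ := by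
      rw [Finset.sum_eq_single q, Finset.sum_eq_single p] <;>
        simp +contextual [Matrix.single_apply, abs_inv, eq_comm]
    rw [hsum, inv_le_iff_one_le_mul₀' hpos, ← h]
    exact hle
end

section
/- Let A be a real m×n matrix, H a real n×m matrix with AHA = A, and W a real m×n matrix. Then ⟨A, W⟩ ≤ ‖Aᵀ W Aᵀ‖_max · ‖H‖₁, where ⟨A, W⟩ := trace(Aᵀ W). In particular, if ‖Aᵀ W Aᵀ‖_max ≤ 1, then ⟨A, W⟩ ≤ ‖H‖₁. -/
open Matrix

namespace Matrix

variable {m n : Type*} [Fintype m] [Fintype n]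

theorem trace_transpose_mul_eq_sum (H M : Matrix n m ℝ) :
    (Hᵀ * M).trace = ∑ i, ∑ j, H i j * M i j := by
  simp only [trace, diag_apply, mul_apply, transpose_apply]
  exact Finset.sum_comm

theorem trace_transpose_mul_le_of_abs_le (H M : Matrix n m ℝ) {c : ℝ}
    (hM : ∀ i j, |M i j| ≤ c) :
    (Hᵀ * M).trace ≤ c * ∑ i, ∑ j, |H i j| := by
  rw [trace_transpose_mul_eq_sum]
  simp only [Finset.mul_sum]
  refine Finset.sum_le_sum fun i _ => Finset.sum_le_sum fun j _ => ?_
  calc H i j * M i j ≤ |H i j| * |M i j| := (le_abs_self _).trans_eq (abs_mul _ _)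
    _ ≤ |H i j| * c := mul_le_mul_of_nonneg_left (hM i j) (abs_nonneg _)
    _ = c * |H i j| := mul_comm _ _

theorem trace_transpose_mul_eq_of_mul_mul_eq {A W : Matrix m n ℝ} {H : Matrix n m ℝ}
    (h : A * H * A = A) :
    (Aᵀ * W).trace = (Hᵀ * (Aᵀ * W * Aᵀ)).trace := by
  conv_lhs => rw [← h]
  rw [transpose_mul, transpose_mul, Matrix.mul_assoc, trace_mul_comm]
  simp only [Matrix.mul_assoc]

theorem abs_apply_le_iSup_iSup (M : Matrix n m ℝ) (i : n) (j : m) :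
    |M i j| ≤ ⨆ i, ⨆ j, |M i j| :=
  (le_ciSup (Set.finite_range fun j => |M i j|).bddAbove j).trans
    (le_ciSup (Set.finite_range fun i => ⨆ j, |M i j|).bddAbove i)

end Matrix

/-- Weak duality: if `A H A = A` then `⟨A, W⟩ ≤ ‖Aᵀ W Aᵀ‖_max ⬝ ‖H‖₁`;
in particular, if `‖Aᵀ W Aᵀ‖_max ≤ 1` then `⟨A, W⟩ ≤ ‖H‖₁`. -/
theorem stmt_10 (m n : ℕ) (A : Matrix (Fin m) (Fin n) ℝ)
    (H : Matrix (Fin n) (Fin m) ℝ) (W : Matrix (Fin m) (Fin n) ℝ)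
    (hP1 : A * H * A = A) :
    (Aᵀ * W).trace ≤ (⨆ i, ⨆ j, |(Aᵀ * W * Aᵀ) i j|) * ∑ i, ∑ j, |H i j| ∧
    ((∀ i j, |(Aᵀ * W * Aᵀ) i j| ≤ 1) →
      (Aᵀ * W).trace ≤ ∑ i, ∑ j, |H i j|) := by
  rw [trace_transpose_mul_eq_of_mul_mul_eq hP1]
  refine ⟨trace_transpose_mul_le_of_abs_le H _ (abs_apply_le_iSup_iSup _), fun h => ?_⟩
  simpa only [one_mul] using trace_transpose_mul_le_of_abs_le H _ h
end

section
/- Let A be a real m×n matrix of rank 2 with all entries nonnegative. Let Ã be a nonsingular 2×2 submatrix of A that minimizes ‖Ã⁻¹‖₁ among all nonsingular 2×2 submatrices of A, and let H be the n×m matrix whose 2×2 submatrix in the position corresponding to Ã equals Ã⁻¹, with all other entries zero. Then H is a generalized inverse of A with minimum entrywise 1-norm: for every n×m matrix H' with A H' A = A, ‖H‖₁ ≤ ‖H'‖₁. Moreover, H is a reflexive generalized inverse of A (HAH = H). -/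
open Matrix

namespace Matrix

/-- If replacing either of two generators by the combination `x • s + y • t` does not decrease
the weighted volume, then the coefficients `x` and `y` differ by at most `1`. -/
lemma abs_sub_le_one_of_weighted {s t x y : ℝ} (hs : 0 < s) (ht : 0 < t)
    (hx : (s + t) * |x| ≤ x * s + y * t + t) (hy : (s + t) * |y| ≤ x * s + y * t + s) :
    |x - y| ≤ 1 := by
  have hx' : (s + t) * x ≤ x * s + y * t + t :=
    (mul_le_mul_of_nonneg_left (le_abs_self x) (by positivity)).trans hx
  have hy' : (s + t) * y ≤ x * s + y * t + s :=
    (mul_le_mul_of_nonneg_left (le_abs_self y) (by positivity)).trans hy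
  rw [abs_le]
  constructor <;> nlinarith

lemma sum_abs_inv_fin_two (N : Matrix (Fin 2) (Fin 2) ℝ) (hN : ∀ i j, 0 ≤ N i j) :
    ∑ a, ∑ b, |N⁻¹ a b| = (∑ a, ∑ b, N a b) / |N.det| := by
  simp only [inv_def, Ring.inverse_eq_inv', adjugate_fin_two, smul_apply, smul_eq_mul, abs_mul,
    abs_inv, Fin.sum_univ_two, of_apply, cons_val', cons_val_zero, cons_val_one, cons_val_fin_one,
    abs_neg, abs_of_nonneg (hN _ _)]
  ring

lemma abs_sum_signed_inv_fin_two (N : Matrix (Fin 2) (Fin 2) ℝ) (hN : ∀ i j, 0 ≤ N i j) :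
    |N⁻¹ 0 0 - N⁻¹ 0 1 - N⁻¹ 1 0 + N⁻¹ 1 1| = ∑ a, ∑ b, |N⁻¹ a b| := by
  have hsum : 0 ≤ ∑ a, ∑ b, N a b :=
    Finset.sum_nonneg fun a _ => Finset.sum_nonneg fun b _ => hN a b
  rw [sum_abs_inv_fin_two N hN, ← abs_of_nonneg hsum, ← abs_div]
  congr 1
  simp only [inv_def, Ring.inverse_eq_inv', adjugate_fin_two, smul_apply, smul_eq_mul,
    Fin.sum_univ_two, of_apply, cons_val', cons_val_zero, cons_val_one, cons_val_fin_one]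
  ring

/-- If replacing a column of a nonnegative `N` by `c` never decreases the 1-norm of the inverse,
then the coordinates of `c` in the columns of `N` differ by at most `1`. -/
lemma abs_inv_mulVec_sub_le_one (N : Matrix (Fin 2) (Fin 2) ℝ) (hN : ∀ i j, 0 ≤ N i j)
    (hdet : N.det ≠ 0) (c : Fin 2 → ℝ) (hc : ∀ i, 0 ≤ c i)
    (hmin : ∀ k, (N.updateCol k c).det ≠ 0 →
      ∑ a, ∑ b, |N⁻¹ a b| ≤ ∑ a, ∑ b, |(N.updateCol k c)⁻¹ a b|) :
    |(N⁻¹ *ᵥ c) 0 - (N⁻¹ *ᵥ c) 1| ≤ 1 := by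
  set x := N⁻¹ *ᵥ c with hx
  have hNx : N *ᵥ x = c := by
    rw [hx, mulVec_mulVec, mul_nonsing_inv _ hdet.isUnit, one_mulVec]
  have h0 : N 0 0 * x 0 + N 0 1 * x 1 = c 0 := by
    simpa [mulVec, dotProduct, Fin.sum_univ_two] using congrFun hNx 0
  have h1 : N 1 0 * x 0 + N 1 1 * x 1 = c 1 := by
    simpa [mulVec, dotProduct, Fin.sum_univ_two] using congrFun hNx 1
  have hcol : ∀ k, 0 < N 0 k + N 1 k := by
    intro k
    refine (add_nonneg (hN 0 k) (hN 1 k)).lt_of_ne' fun h => hdet ?_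
    have e0 : N 0 k = 0 := by linarith [hN 0 k, hN 1 k]
    have e1 : N 1 k = 0 := by linarith [hN 0 k, hN 1 k]
    exact det_eq_zero_of_column_eq_zero k (Fin.forall_fin_two.2 ⟨e0, e1⟩)
  have hscaled : ∀ k, (N.updateCol k c).det = x k * N.det := by
    refine Fin.forall_fin_two.2 ⟨?_, ?_⟩ <;>
      simp [det_fin_two, ← h0, ← h1] <;> ring
  have hbound : ∀ k, (∑ a, ∑ b, N a b) * |x k| ≤ ∑ a, ∑ b, N.updateCol k c a b := by
    intro k
    have hup : ∀ i j, 0 ≤ N.updateCol k c i j := by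
      intro i j
      rw [updateCol_apply]
      split_ifs
      exacts [hc i, hN i j]
    by_cases hk : x k = 0
    · rw [hk, abs_zero, mul_zero]
      exact Finset.sum_nonneg fun a _ => Finset.sum_nonneg fun b _ => hup a b
    · have h := hmin k (by rw [hscaled]; exact mul_ne_zero hk hdet)
      rw [sum_abs_inv_fin_two N hN, sum_abs_inv_fin_two _ hup, hscaled, abs_mul,
        div_le_div_iff₀ (abs_pos.2 hdet) (mul_pos (abs_pos.2 hk) (abs_pos.2 hdet)),
        ← mul_assoc] at h
      exact le_of_mul_le_mul_right h (abs_pos.2 hdet)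
  have b0 := hbound 0
  have b1 := hbound 1
  simp [Fin.sum_univ_two, updateCol_apply] at b0 b1
  refine abs_sub_le_one_of_weighted (hcol 0) (hcol 1) ?_ ?_ <;> linarith

/-- The coordinates of a column of a nonnegative matrix in the two columns of a submatrix whose
inverse has minimal 1-norm differ by at most `1`. -/
lemma abs_inv_mul_submatrix_sub_le_one {m n : Type*} (A : Matrix m n ℝ)
    (hA : ∀ i j, 0 ≤ A i j) (ρ : Fin 2 → m) (κ : Fin 2 → n) (hdet : (A.submatrix ρ κ).det ≠ 0)
    (hmin : ∀ κ' : Fin 2 → n, (A.submatrix ρ κ').det ≠ 0 →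
      ∑ a, ∑ b, |(A.submatrix ρ κ)⁻¹ a b| ≤ ∑ a, ∑ b, |(A.submatrix ρ κ')⁻¹ a b|) (i : n) :
    |((A.submatrix ρ κ)⁻¹ * A.submatrix ρ id) 0 i -
      ((A.submatrix ρ κ)⁻¹ * A.submatrix ρ id) 1 i| ≤ 1 := by
  refine abs_inv_mulVec_sub_le_one (A.submatrix ρ κ) (fun _ _ => hA _ _) hdet
    (fun a => A (ρ a) i) (fun _ => hA _ _) fun k => ?_
  have hupdate : (A.submatrix ρ κ).updateCol k (fun a => A (ρ a) i) =
      A.submatrix ρ (Function.update κ k i) := by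
    ext a b
    by_cases h : b = k
    · subst h; simp
    · simp [h]
  rw [hupdate]
  exact hmin _

/-- A matrix of rank `r` factors through the inverse of any nonsingular `r × r` submatrix. -/
lemma submatrix_mul_inv_mul_submatrix {m n r K : Type*} [Fintype m] [Fintype n] [Fintype r]
    [DecidableEq r] [Field K] (A : Matrix m n K) (hrank : A.rank = Fintype.card r)
    (ρ : r → m) (κ : r → n) (hdet : (A.submatrix ρ κ).det ≠ 0) :
    A.submatrix id κ * (A.submatrix ρ κ)⁻¹ * A.submatrix ρ id = A := by
  classical
  have hcols : A.submatrix id κ = A * (1 : Matrix n n K).submatrix id κ := by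
    rw [← submatrix_id_id A, ← submatrix_mul _ _ _ _ _ Function.bijective_id]; simp
  have hle : LinearMap.range (A.submatrix id κ).mulVecLin ≤ LinearMap.range A.mulVecLin := by
    rw [hcols, mulVecLin_mul]
    exact LinearMap.range_comp_le_range _ _
  have hcard : Fintype.card r ≤ (A.submatrix id κ).rank := by
    rw [← rank_of_isUnit (A.submatrix ρ κ) ((isUnit_iff_isUnit_det _).2 hdet.isUnit)]
    exact rank_submatrix_le (A := A.submatrix id κ) ρ id
  have hrange : LinearMap.range (A.submatrix id κ).mulVecLin = LinearMap.range A.mulVecLin :=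
    Submodule.eq_of_le_of_finrank_le hle (hrank.trans_le hcard)
  have hmem : ∀ j, ∃ z, A.submatrix id κ *ᵥ z = A.col j := by
    intro j
    have : A.col j ∈ LinearMap.range A.mulVecLin := ⟨Pi.single j 1, by simp⟩
    rwa [← hrange] at this
  choose z hz using hmem
  have hfactor : A = A.submatrix id κ * (of z)ᵀ := by
    ext i j
    exact (congrFun (hz j) i).symm
  have hrows : A.submatrix ρ id = A.submatrix ρ κ * (of z)ᵀ := by
    ext i j
    exact congrFun (congrFun hfactor (ρ i)) j
  rw [hrows, Matrix.mul_assoc, nonsing_inv_mul_cancel_left _ _ hdet.isUnit, ← hfactor]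

/-- Pairing with weights of absolute value at most `1` is bounded by the entrywise 1-norm. -/
lemma abs_sum_mul_mul_le {m n : Type*} [Fintype m] [Fintype n] (H : Matrix m n ℝ)
    (u : m → ℝ) (v : n → ℝ) (hu : ∀ i, |u i| ≤ 1) (hv : ∀ j, |v j| ≤ 1) :
    |u ⬝ᵥ H *ᵥ v| ≤ ∑ i, ∑ j, |H i j| := by
  simp only [dotProduct, mulVec, Finset.mul_sum]
  refine (Finset.abs_sum_le_sum_abs _ _).trans (Finset.sum_le_sum fun i _ => ?_)
  refine (Finset.abs_sum_le_sum_abs _ _).trans (Finset.sum_le_sum fun j _ => ?_)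
  rw [abs_mul, abs_mul]
  calc |u i| * (|H i j| * |v j|) ≤ 1 * (|H i j| * 1) := by
        gcongr
        exacts [hu i, hv j]
    _ = |H i j| := by ring

end Matrix

/-- For a nonnegative rank-2 matrix `A`, placing the inverse of a nonsingular
`2 × 2` submatrix `Ã` minimizing `‖Ã⁻¹‖₁` (and zeros elsewhere) yields a
1-norm minimizing generalized inverse of `A`, which is moreover reflexive. -/
theorem stmt_12 (m n : ℕ) (A : Matrix (Fin m) (Fin n) ℝ)
    (hrank : A.rank = 2) (hnonneg : ∀ i j, 0 ≤ A i j)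
    (ρ : Fin 2 → Fin m) (κ : Fin 2 → Fin n)
    (hρ : Function.Injective ρ) (hκ : Function.Injective κ)
    (hns : (A.submatrix ρ κ).det ≠ 0)
    (hmin : ∀ (ρ' : Fin 2 → Fin m) (κ' : Fin 2 → Fin n),
      Function.Injective ρ' → Function.Injective κ' →
      (A.submatrix ρ' κ').det ≠ 0 →
      ∑ a, ∑ b, |(A.submatrix ρ κ)⁻¹ a b| ≤
        ∑ a, ∑ b, |(A.submatrix ρ' κ')⁻¹ a b|)
    (H : Matrix (Fin n) (Fin m) ℝ)
    (hH₁ : ∀ a b, H (κ a) (ρ b) = (A.submatrix ρ κ)⁻¹ a b)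
    (hH₂ : ∀ i j, ((∀ a, κ a ≠ i) ∨ (∀ b, ρ b ≠ j)) → H i j = 0) :
    (∀ H' : Matrix (Fin n) (Fin m) ℝ, A * H' * A = A →
      ∑ i, ∑ j, |H i j| ≤ ∑ i, ∑ j, |H' i j|) ∧
    A * H * A = A ∧ H * A * H = H := by
  have hmin' : ∀ (ρ' : Fin 2 → Fin m) (κ' : Fin 2 → Fin n), (A.submatrix ρ' κ').det ≠ 0 →
      ∑ a, ∑ b, |(A.submatrix ρ κ)⁻¹ a b| ≤ ∑ a, ∑ b, |(A.submatrix ρ' κ')⁻¹ a b| := by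
    intro ρ' κ' h
    refine hmin ρ' κ' (fun a b hab => ?_) (fun a b hab => ?_) h <;> by_contra hne <;> apply h
    · exact det_zero_of_row_eq hne (funext fun k => by simp [hab])
    · exact det_zero_of_column_eq hne fun k => by simp [hab]
  have hcol := abs_inv_mul_submatrix_sub_le_one A hnonneg ρ κ hns (hmin' ρ)
  have hrow := abs_inv_mul_submatrix_sub_le_one Aᵀ (fun i j => hnonneg j i) κ ρ
    (by rwa [← transpose_submatrix, det_transpose]) (by
      intro ρ' h
      rw [← transpose_submatrix, det_transpose] at h
      simp only [← transpose_submatrix, ← transpose_nonsing_inv, transpose_apply]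
      rw [Finset.sum_comm, Finset.sum_comm (f := fun a b => |(A.submatrix ρ' κ)⁻¹ b a|)]
      exact hmin' ρ' κ h)
  simp only [← transpose_submatrix, ← transpose_nonsing_inv, ← transpose_mul,
    transpose_apply] at hrow
  have hfactor := submatrix_mul_inv_mul_submatrix A (by simpa using hrank) ρ κ hns
  set B := (A.submatrix ρ κ)⁻¹ with hB
  have hBAB : B * A.submatrix ρ κ * B = B := by
    rw [hB, nonsing_inv_mul _ hns.isUnit, Matrix.one_mul]
  set P : Matrix (Fin n) (Fin 2) ℝ := (1 : Matrix (Fin n) (Fin n) ℝ).submatrix id κ with hP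
  set Q : Matrix (Fin 2) (Fin m) ℝ := (1 : Matrix (Fin m) (Fin m) ℝ).submatrix ρ id with hQ
  have hAP : A * P = A.submatrix id κ := by
    rw [hP, ← submatrix_id_id A, ← submatrix_mul _ _ _ _ _ Function.bijective_id]; simp
  have hQA : Q * A = A.submatrix ρ id := by
    rw [hQ, ← submatrix_id_id A, ← submatrix_mul _ _ _ _ _ Function.bijective_id]; simp
  have hQAP : Q * A * P = A.submatrix ρ κ := by
    rw [Matrix.mul_assoc, hAP, hQ, ← submatrix_id_id (A.submatrix id κ),
      ← submatrix_mul _ _ _ _ _ Function.bijective_id]; simp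
  have hH : H = P * B * Q := by
    ext i j
    by_cases hi : ∃ a, κ a = i
    · obtain ⟨a, rfl⟩ := hi
      by_cases hj : ∃ b, ρ b = j
      · obtain ⟨b, rfl⟩ := hj
        simp [hH₁, hP, hQ, mul_apply, one_apply, hκ.eq_iff, hρ.eq_iff]
      · rw [hH₂ _ _ (Or.inr (not_exists.1 hj))]
        simp [hQ, mul_apply, one_apply, not_exists.1 hj]
    · rw [hH₂ _ _ (Or.inl (not_exists.1 hi))]
      simp [hP, mul_apply, one_apply, fun a => Ne.symm (not_exists.1 hi a)]
  refine ⟨fun H' hH' => ?_, ?_, ?_⟩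
  · have hnorm : ∑ i, ∑ j, |H i j| = ∑ a, ∑ b, |B a b| := by
      rw [← Fintype.sum_of_injective κ hκ (fun a => ∑ b, |B a b|) (fun i => ∑ j, |H i j|)]
      · intro i hi
        refine Finset.sum_eq_zero fun j _ => ?_
        rw [hH₂ i j (Or.inl fun a ha => hi ⟨a, ha⟩), abs_zero]
      · intro a
        refine Fintype.sum_of_injective ρ hρ _ _ (fun j hj => ?_) fun b => by rw [hH₁]
        rw [hH₂ _ j (Or.inr fun b hb => hj ⟨b, hb⟩), abs_zero]
    have hXHY : (B * A.submatrix ρ id) * H' * (A.submatrix id κ * B) = B := by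
      calc _ = B * (Q * (A * H' * A) * P) * B := by
            rw [← hQA, ← hAP]; simp only [Matrix.mul_assoc]
        _ = B := by rw [hH', hQAP, hBAB]
    have hpair := abs_sum_mul_mul_le H' (![1, -1] ᵥ* (B * A.submatrix ρ id))
      ((A.submatrix id κ * B) *ᵥ ![1, -1])
      (fun i => by
        simpa [vecMul, dotProduct, Fin.sum_univ_two, ← sub_eq_add_neg] using hcol i)
      (fun j => by
        simpa [mulVec, dotProduct, Fin.sum_univ_two, ← sub_eq_add_neg] using hrow j)
    rw [← dotProduct_mulVec, mulVec_mulVec, mulVec_mulVec, hXHY] at hpair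
    rw [hnorm, ← abs_sum_signed_inv_fin_two (A.submatrix ρ κ) fun _ _ => hnonneg _ _]
    refine le_trans (le_of_eq ?_) hpair
    congr 1
    simp only [← hB, dotProduct, mulVec, Fin.sum_univ_two, cons_val_zero, cons_val_one,
      cons_val_fin_one]
    ring
  · calc A * H * A = A * P * B * (Q * A) := by rw [hH]; simp only [Matrix.mul_assoc]
      _ = A := by rw [hAP, hQA, hfactor]
  · calc H * A * H = P * (B * (Q * A * P) * B) * Q := by rw [hH]; simp only [Matrix.mul_assoc]
      _ = H := by rw [hQAP, hBAB, hH]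
end

section
/- Let A be a real m×n matrix of rank r given in block form A = [[Ã, B], [C, D]], where Ã is an r×r invertible north-west block (so that D = C Ã⁻¹ B). Let ε ≥ 0 and suppose ‖Ã⁻¹ B‖_max ≤ 1+ε and ‖C Ã⁻¹‖_max ≤ 1+ε. Define the m×n matrix W := [[Ã⁻ᵀ(2I_r − J_r)Ã⁻ᵀ, 0], [0, 0]]. Then ‖Aᵀ W Aᵀ‖_max ≤ r²(1+ε)². -/
open Matrix

/-- Entrywise bounds multiply under matrix products, up to the inner dimension. -/
theorem abs_mul_apply_le {ι κ l : Type*} [Fintype κ] {M : Matrix ι κ ℝ} {N : Matrix κ l ℝ}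
    {a b : ℝ} (hM : ∀ i k, |M i k| ≤ a) (hN : ∀ k j, |N k j| ≤ b) (i : ι) (j : l) :
    |(M * N) i j| ≤ Fintype.card κ * (a * b) := by
  rw [mul_apply]
  calc |∑ k, M i k * N k j| ≤ ∑ k, |M i k * N k j| := Finset.abs_sum_le_sum_abs _ _
    _ ≤ ∑ _k : κ, a * b := by
        refine Finset.sum_le_sum fun k _ => ?_
        rw [abs_mul]
        exact mul_le_mul (hM i k) (hN k j) (abs_nonneg _) ((abs_nonneg _).trans (hM i k))
    _ = Fintype.card κ * (a * b) := by simp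

theorem abs_one_apply_le {n : Type*} [DecidableEq n] (i j : n) :
    |(1 : Matrix n n ℝ) i j| ≤ 1 := by
  rw [one_apply]
  split_ifs <;> simp

/-- Sandwiching `Ã⁻ᵀ K Ã⁻ᵀ`, padded by zeros, between two copies of `Aᵀ` cancels `Ã`. -/
theorem transpose_fromBlocks_mul_mul {n p q R : Type*} [Fintype n] [DecidableEq n] [Fintype p]
    [Fintype q] [CommRing R] {Atil : Matrix n n R} (hinv : IsUnit Atil) (B : Matrix n q R)
    (C : Matrix p n R) (D : Matrix p q R) (K : Matrix n n R) :
    (fromBlocks Atil B C D)ᵀ *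
        (fromBlocks (Atil⁻¹ᵀ * K * Atil⁻¹ᵀ) 0 0 0 : Matrix (n ⊕ p) (n ⊕ q) R) *
        (fromBlocks Atil B C D)ᵀ =
      fromRows (1 : Matrix n n R) (Atil⁻¹ * B)ᵀ * K *
        fromCols (1 : Matrix n n R) (C * Atil⁻¹)ᵀ := by
  have hdet := (isUnit_iff_isUnit_det Atil).mp hinv
  have h₁ : Atilᵀ * Atil⁻¹ᵀ = 1 := by
    rw [← transpose_mul, nonsing_inv_mul _ hdet, transpose_one]
  have h₂ : Atil⁻¹ᵀ * Atilᵀ = 1 := by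
    rw [← transpose_mul, mul_nonsing_inv _ hdet, transpose_one]
  have h₃ (X : Matrix n n R) : Atilᵀ * (Atil⁻¹ᵀ * X) = X := by
    rw [← Matrix.mul_assoc, h₁, Matrix.one_mul]
  simp [fromBlocks_transpose, fromBlocks_multiply, fromRows_mul,
    Matrix.mul_assoc, h₂, h₃]

/-- Dual-feasibility bound: for a rank-`r` matrix `A = [[Ã, B], [C, D]]`
with `Ã` invertible, `‖Ã⁻¹ B‖_max ≤ 1 + ε` and `‖C Ã⁻¹‖_max ≤ 1 + ε`,
the matrix `W = [[Ã⁻ᵀ (2 I_r - J_r) Ã⁻ᵀ, 0], [0, 0]]` satisfies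
`‖Aᵀ W Aᵀ‖_max ≤ r² (1 + ε)²`. -/
theorem stmt_16 (r p q : ℕ)
    (Atil : Matrix (Fin r) (Fin r) ℝ) (B : Matrix (Fin r) (Fin q) ℝ)
    (C : Matrix (Fin p) (Fin r) ℝ) (D : Matrix (Fin p) (Fin q) ℝ)
    (A : Matrix (Fin r ⊕ Fin p) (Fin r ⊕ Fin q) ℝ)
    (hA : A = fromBlocks Atil B C D)
    (hrank : A.rank = r) (hinv : IsUnit Atil)
    (ε : ℝ) (hε : 0 ≤ ε)
    (hB : ∀ i j, |(Atil⁻¹ * B) i j| ≤ 1 + ε)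
    (hC : ∀ i j, |(C * Atil⁻¹) i j| ≤ 1 + ε)
    (J : Matrix (Fin r) (Fin r) ℝ) (hJ : J = of fun _ _ => (1 : ℝ))
    (W : Matrix (Fin r ⊕ Fin p) (Fin r ⊕ Fin q) ℝ)
    (hW : W = fromBlocks
      (Atil⁻¹ᵀ * (2 • (1 : Matrix (Fin r) (Fin r) ℝ) - J) * Atil⁻¹ᵀ) 0 0 0) :
    ∀ i j, |(Aᵀ * W * Aᵀ) i j| ≤ (r : ℝ) ^ 2 * (1 + ε) ^ 2 := by
  have hone : (1 : ℝ) ≤ 1 + ε := le_add_of_nonneg_right hε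
  have hK (k l : Fin r) : |(2 • (1 : Matrix (Fin r) (Fin r) ℝ) - J) k l| ≤ 1 := by
    rw [hJ, Matrix.sub_apply, Matrix.smul_apply, one_apply]
    split_ifs <;> norm_num
  have hP (i : Fin r ⊕ Fin q) (k : Fin r) :
      |fromRows (1 : Matrix (Fin r) (Fin r) ℝ) (Atil⁻¹ * B)ᵀ i k| ≤ 1 + ε := by
    cases i with
    | inl i => exact (abs_one_apply_le i k).trans hone
    | inr i => exact hB k i
  have hQ (k : Fin r) (j : Fin r ⊕ Fin p) :
      |fromCols (1 : Matrix (Fin r) (Fin r) ℝ) (C * Atil⁻¹)ᵀ k j| ≤ 1 + ε := by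
    cases j with
    | inl j => exact (abs_one_apply_le k j).trans hone
    | inr j => exact hC j k
  intro i j
  rw [hA, hW, transpose_fromBlocks_mul_mul hinv]
  refine (abs_mul_apply_le (abs_mul_apply_le hP hK) hQ i j).trans_eq ?_
  rw [Fintype.card_fin]
  ring
end

section
/- Let A be a real m×n matrix of rank r and let ε ≥ 0. Let Ã = A[σ,τ] be an r×r nonsingular submatrix of A that is a (1+ε)-local maximizer for the absolute determinant: no single swap of one row index of σ with an index outside σ, or of one column index of τ with an index outside τ, yields an r×r submatrix whose absolute determinant exceeds (1+ε)|det(Ã)|. Let H be the n×m matrix whose r×r submatrix in the position corresponding to Ã equals Ã⁻¹, with all other entries zero. Then H is a reflexive generalized inverse of A (AHA = A and HAH = H), H has at most r² nonzero entries, and for every n×m matrix H' with A H' A = A, ‖H‖₁ ≤ r²(1+ε)² ‖H'‖₁. -/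
open Matrix

/-- The skeleton (CUR) factorization of a rank-`r` matrix through a nonsingular `r × r` submatrix. -/
theorem submatrix_mul_inv_mul_submatrix_of_rank_eq {K : Type*} [Field K] {m n r : ℕ}
    (A : Matrix (Fin m) (Fin n) K) (hrank : A.rank = r) (σ : Fin r → Fin m) (τ : Fin r → Fin n)
    (hns : (A.submatrix σ τ).det ≠ 0) :
    A.submatrix id τ * (A.submatrix σ τ)⁻¹ * A.submatrix σ id = A := by
  have hu : IsUnit (A.submatrix σ τ).det := hns.isUnit
  have hC : A.submatrix id τ = A * (1 : Matrix (Fin n) (Fin n) K).submatrix id τ := by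
    ext i k
    simp [Matrix.mul_apply, Matrix.one_apply]
  have hB : A.submatrix σ τ =
      (1 : Matrix (Fin m) (Fin m) K).submatrix σ id * A.submatrix id τ := by
    ext i k
    simp [Matrix.mul_apply, Matrix.one_apply]
  have hBrank : (A.submatrix σ τ).rank = r := by
    simpa using Matrix.rank_of_isUnit _ ((Matrix.isUnit_iff_isUnit_det _).2 hu)
  have hle : LinearMap.range (A.submatrix id τ).mulVecLin ≤ LinearMap.range A.mulVecLin := by
    rw [hC, Matrix.mulVecLin_mul]
    exact LinearMap.range_comp_le_range _ _
  have hCrank : A.rank ≤ (A.submatrix id τ).rank := by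
    rw [hrank]
    refine hBrank.symm.le.trans ?_
    rw [hB]
    exact Matrix.rank_mul_le_right _ _
  have hrange := Submodule.eq_of_le_of_finrank_le hle hCrank
  have hcol : ∀ j, ∃ v, A.submatrix id τ *ᵥ v = A.col j := by
    intro j
    have hj : A.col j ∈ LinearMap.range A.mulVecLin :=
      ⟨Pi.single j 1, by simp⟩
    rw [← hrange] at hj
    exact hj
  choose Z hZ using hcol
  have hA : A.submatrix id τ * (Matrix.of Z)ᵀ = A := by
    ext i j
    exact congrFun (hZ j) i
  have hR : A.submatrix σ τ * (Matrix.of Z)ᵀ = A.submatrix σ id := by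
    ext a j
    exact congrFun (hZ j) (σ a)
  rw [← hR, Matrix.mul_assoc, Matrix.nonsing_inv_mul_cancel_left _ _ hu, hA]

/-- By Cramer's rule, the entries of `A[·, τ] * A[σ, τ]⁻¹` are ratios of determinants of
submatrices differing by a row swap. -/
theorem submatrix_mul_inv_apply_mul_det {K : Type*} [Field K] {m n r : ℕ}
    (A : Matrix (Fin m) (Fin n) K) (σ : Fin r → Fin m) (τ : Fin r → Fin n)
    (hns : (A.submatrix σ τ).det ≠ 0) (i : Fin m) (k : Fin r) :
    (A.submatrix id τ * (A.submatrix σ τ)⁻¹) i k * (A.submatrix σ τ).det =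
      (A.submatrix (Function.update σ k i) τ).det := by
  have hX : A.submatrix id τ * (A.submatrix σ τ)⁻¹ * A.submatrix σ τ = A.submatrix id τ :=
    Matrix.nonsing_inv_mul_cancel_right _ _ hns.isUnit
  have hupd : A.submatrix (Function.update σ k i) τ = (A.submatrix σ τ).updateRow k
      (∑ l, (A.submatrix id τ * (A.submatrix σ τ)⁻¹) i l • (A.submatrix σ τ) l) := by
    ext a b
    by_cases h : a = k
    · subst h
      simpa [Matrix.mul_apply, Finset.sum_apply] using (congrFun (congrFun hX i) b).symm
    · simp [h]
  rw [hupd, Matrix.det_updateRow_sum, smul_eq_mul]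

theorem abs_submatrix_mul_inv_apply_le {m n r : ℕ} (A : Matrix (Fin m) (Fin n) ℝ)
    (σ : Fin r → Fin m) (τ : Fin r → Fin n) (hns : (A.submatrix σ τ).det ≠ 0)
    {c : ℝ} (hc : 1 ≤ c)
    (hswap : ∀ (k : Fin r) (i : Fin m), (∀ l, σ l ≠ i) →
      |(A.submatrix (Function.update σ k i) τ).det| ≤ c * |(A.submatrix σ τ).det|)
    (i : Fin m) (k : Fin r) :
    |(A.submatrix id τ * (A.submatrix σ τ)⁻¹) i k| ≤ c := by
  by_cases h : ∃ l, σ l = i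
  · obtain ⟨l, rfl⟩ := h
    have h1 : (A.submatrix id τ * (A.submatrix σ τ)⁻¹) (σ l) k =
        (1 : Matrix (Fin r) (Fin r) ℝ) l k := by
      rw [← Matrix.mul_nonsing_inv _ hns.isUnit]
      rfl
    rw [h1, Matrix.one_apply]
    split_ifs <;> simp <;> linarith
  · push Not at h
    refine le_of_mul_le_mul_right ?_ (abs_pos.2 hns)
    rw [← abs_mul, submatrix_mul_inv_apply_mul_det A σ τ hns]
    exact hswap k i h

/-- The transposed form of `abs_submatrix_mul_inv_apply_le`, for column swaps. -/
theorem abs_inv_mul_submatrix_apply_le {m n r : ℕ} (A : Matrix (Fin m) (Fin n) ℝ)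
    (σ : Fin r → Fin m) (τ : Fin r → Fin n) (hns : (A.submatrix σ τ).det ≠ 0)
    {c : ℝ} (hc : 1 ≤ c)
    (hswap : ∀ (k : Fin r) (j : Fin n), (∀ l, τ l ≠ j) →
      |(A.submatrix σ (Function.update τ k j)).det| ≤ c * |(A.submatrix σ τ).det|)
    (k : Fin r) (j : Fin n) :
    |((A.submatrix σ τ)⁻¹ * A.submatrix σ id) k j| ≤ c := by
  have hdet : ∀ τ' : Fin r → Fin n, (Aᵀ.submatrix τ' σ).det = (A.submatrix σ τ').det :=
    fun τ' => by rw [← Matrix.transpose_submatrix, Matrix.det_transpose]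
  have h := abs_submatrix_mul_inv_apply_le Aᵀ τ σ (by rwa [hdet]) hc
    (by simpa only [hdet] using hswap) j k
  rwa [← Matrix.transpose_submatrix, ← Matrix.transpose_submatrix, ← Matrix.transpose_nonsing_inv,
    ← Matrix.transpose_mul] at h

/-- Entrywise bound on `Y * M * X` when the entries of `X` and `Y` are bounded. -/
theorem abs_mul_mul_apply_le {ι κ m n : Type*} [Fintype m] [Fintype n]
    (Y : Matrix ι n ℝ) (M : Matrix n m ℝ) (X : Matrix m κ ℝ) {c : ℝ} (hc : 0 ≤ c)
    (hY : ∀ a j, |Y a j| ≤ c) (hX : ∀ i b, |X i b| ≤ c) (a : ι) (b : κ) :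
    |(Y * M * X) a b| ≤ c ^ 2 * ∑ j, ∑ i, |M j i| := by
  calc |(Y * M * X) a b| = |∑ j, ∑ i, Y a j * M j i * X i b| := by
        rw [Finset.sum_comm]
        simp only [Matrix.mul_apply, Finset.sum_mul]
    _ ≤ ∑ j, ∑ i, |Y a j * M j i * X i b| :=
        (Finset.abs_sum_le_sum_abs _ _).trans
          (Finset.sum_le_sum fun j _ => Finset.abs_sum_le_sum_abs _ _)
    _ ≤ ∑ j, ∑ i, c ^ 2 * |M j i| := by
        refine Finset.sum_le_sum fun j _ => Finset.sum_le_sum fun i _ => ?_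
        rw [abs_mul, abs_mul]
        calc |Y a j| * |M j i| * |X i b| ≤ c * |M j i| * c := by
              gcongr
              · exact hY a j
              · exact hX i b
          _ = c ^ 2 * |M j i| := by ring
    _ = c ^ 2 * ∑ j, ∑ i, |M j i| := by simp only [Finset.mul_sum]

/-- A sum whose terms vanish off the range of an injection reduces to a sum over its domain. -/
theorem sum_eq_sum_comp_of_injective {ι κ M : Type*} [Fintype ι] [Fintype κ] [AddCommMonoid M]
    {f : ι → κ} (hf : Function.Injective f) (g : κ → M) (hg : ∀ j, (∀ a, f a ≠ j) → g j = 0) :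
    ∑ j, g j = ∑ a, g (f a) :=
  (Fintype.sum_of_injective f hf (fun a => g (f a)) g
    (fun j hj => hg j fun a ha => hj ⟨a, ha⟩) fun _ => rfl).symm

/-- Approximation theorem: if `Ã = A[σ, τ]` is an `r × r` nonsingular
submatrix of the rank-`r` matrix `A` that is a `(1 + ε)`-local maximizer of
the absolute determinant, then the matrix `H` carrying `Ã⁻¹` in the
corresponding position (and zeros elsewhere) is a reflexive generalized
inverse of `A` with at most `r²` nonzeros, and its entrywise 1-norm is
within a factor `r² (1 + ε)²` of that of any generalized inverse of `A`. -/
theorem stmt_17 (m n r : ℕ) (A : Matrix (Fin m) (Fin n) ℝ)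
    (hrank : A.rank = r) (ε : ℝ) (hε : 0 ≤ ε)
    (σ : Fin r → Fin m) (τ : Fin r → Fin n)
    (hσ : Function.Injective σ) (hτ : Function.Injective τ)
    (hns : (A.submatrix σ τ).det ≠ 0)
    (hlocrow : ∀ (k : Fin r) (i' : Fin m), (∀ l, σ l ≠ i') →
      |(A.submatrix (Function.update σ k i') τ).det| ≤
        (1 + ε) * |(A.submatrix σ τ).det|)
    (hloccol : ∀ (k : Fin r) (j' : Fin n), (∀ l, τ l ≠ j') →
      |(A.submatrix σ (Function.update τ k j')).det| ≤
        (1 + ε) * |(A.submatrix σ τ).det|)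
    (H : Matrix (Fin n) (Fin m) ℝ)
    (hH₁ : ∀ a b, H (τ a) (σ b) = (A.submatrix σ τ)⁻¹ a b)
    (hH₂ : ∀ i j, ((∀ a, τ a ≠ i) ∨ (∀ b, σ b ≠ j)) → H i j = 0) :
    A * H * A = A ∧ H * A * H = H ∧
    {ij : Fin n × Fin m | H ij.1 ij.2 ≠ 0}.ncard ≤ r ^ 2 ∧
    ∀ H' : Matrix (Fin n) (Fin m) ℝ, A * H' * A = A →
      ∑ i, ∑ j, |H i j| ≤
        (r : ℝ) ^ 2 * (1 + ε) ^ 2 * ∑ i, ∑ j, |H' i j| := by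
  have hu : IsUnit (A.submatrix σ τ).det := hns.isUnit
  have hskel := submatrix_mul_inv_mul_submatrix_of_rank_eq A hrank σ τ hns
  have hAH : A * H = A.submatrix id τ * (A.submatrix σ τ)⁻¹ *
      (1 : Matrix (Fin m) (Fin m) ℝ).submatrix σ id := by
    ext i j
    rw [Matrix.mul_apply, sum_eq_sum_comp_of_injective hτ _
      fun k hk => by rw [hH₂ k j (Or.inl hk), mul_zero]]
    by_cases hj : ∃ b, σ b = j
    · obtain ⟨b, rfl⟩ := hj
      simp [hH₁, Matrix.mul_apply, Matrix.one_apply, hσ.eq_iff]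
    · push Not at hj
      simp [Matrix.mul_apply, hj, fun a => hH₂ (τ a) j (Or.inr hj)]
  have hone : (1 : Matrix (Fin m) (Fin m) ℝ).submatrix σ id * A = A.submatrix σ id := by
    ext i k
    simp [Matrix.mul_apply, Matrix.one_apply]
  have hAHA : A * H * A = A := by
    rw [hAH, Matrix.mul_assoc, hone, hskel]
  refine ⟨hAHA, ?_, ?_, ?_⟩
  · ext i j
    by_cases hi : ∃ a, τ a = i
    · by_cases hj : ∃ b, σ b = j
      · obtain ⟨a, rfl⟩ := hi
        obtain ⟨b, rfl⟩ := hj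
        have hentry : (H * A * H) (τ a) (σ b) =
            ((A.submatrix σ τ)⁻¹ * A.submatrix σ τ * (A.submatrix σ τ)⁻¹) a b := by
          rw [Matrix.mul_apply, sum_eq_sum_comp_of_injective hτ _
            fun k hk => by rw [hH₂ k _ (Or.inl hk), mul_zero], Matrix.mul_apply]
          refine Finset.sum_congr rfl fun c _ => ?_
          rw [hH₁, Matrix.mul_apply, sum_eq_sum_comp_of_injective hσ _
            fun k hk => by rw [hH₂ _ k (Or.inr hk), zero_mul], Matrix.mul_apply]
          simp [hH₁]
        rw [hentry, Matrix.nonsing_inv_mul _ hu, Matrix.one_mul, hH₁]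
      · push Not at hj
        rw [hH₂ i j (Or.inr hj), Matrix.mul_apply]
        exact Finset.sum_eq_zero fun k _ => by rw [hH₂ k j (Or.inr hj), mul_zero]
    · push Not at hi
      rw [hH₂ i j (Or.inl hi), Matrix.mul_assoc, Matrix.mul_apply]
      exact Finset.sum_eq_zero fun k _ => by rw [hH₂ i k (Or.inl hi), zero_mul]
  · have hsub : {ij : Fin n × Fin m | H ij.1 ij.2 ≠ 0} ⊆
        Set.range (Prod.map τ σ) := by
      rintro ⟨i, j⟩ hij
      by_contra hne
      refine hij (hH₂ i j ?_)
      by_contra! h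
      obtain ⟨⟨a, ha⟩, b, hb⟩ := h
      exact hne ⟨(a, b), by simp [ha, hb]⟩
    calc _ ≤ (Set.range (Prod.map τ σ)).ncard := Set.ncard_le_ncard hsub (Set.toFinite _)
      _ = r ^ 2 := by
        rw [Set.ncard_range_of_injective (hτ.prodMap hσ)]
        simp [sq]
  · intro H' hH'
    have hc : (1 : ℝ) ≤ 1 + ε := by linarith
    have hinv : (A.submatrix σ τ)⁻¹ * A.submatrix σ id * H' *
        (A.submatrix id τ * (A.submatrix σ τ)⁻¹) = (A.submatrix σ τ)⁻¹ := by
      have hsub : A.submatrix σ id * H' * A.submatrix id τ = A.submatrix σ τ := by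
        conv_rhs => rw [← hH']
        rfl
      calc _ = (A.submatrix σ τ)⁻¹ * (A.submatrix σ id * H' * A.submatrix id τ) *
            (A.submatrix σ τ)⁻¹ := by simp only [Matrix.mul_assoc]
        _ = _ := by rw [hsub, Matrix.nonsing_inv_mul _ hu, Matrix.one_mul]
    have hbound : ∀ a b, |(A.submatrix σ τ)⁻¹ a b| ≤ (1 + ε) ^ 2 * ∑ i, ∑ j, |H' i j| := by
      intro a b
      rw [← hinv]
      exact abs_mul_mul_apply_le _ _ _ (by linarith)
        (abs_inv_mul_submatrix_apply_le A σ τ hns hc hloccol)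
        (abs_submatrix_mul_inv_apply_le A σ τ hns hc hlocrow) a b
    calc ∑ i, ∑ j, |H i j| = ∑ a, ∑ b, |(A.submatrix σ τ)⁻¹ a b| := by
          rw [sum_eq_sum_comp_of_injective hτ _ fun i hi =>
            Finset.sum_eq_zero fun j _ => by rw [hH₂ i j (Or.inl hi), abs_zero]]
          refine Finset.sum_congr rfl fun a _ => ?_
          rw [sum_eq_sum_comp_of_injective hσ _ fun j hj => by
            rw [hH₂ _ j (Or.inr hj), abs_zero]]
          simp only [hH₁]
      _ ≤ ∑ _a : Fin r, ∑ _b : Fin r, (1 + ε) ^ 2 * ∑ i, ∑ j, |H' i j| :=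
          Finset.sum_le_sum fun a _ => Finset.sum_le_sum fun b _ => hbound a b
      _ = (r : ℝ) ^ 2 * (1 + ε) ^ 2 * ∑ i, ∑ j, |H' i j| := by
          simp only [Finset.sum_const, Finset.card_univ, Fintype.card_fin, nsmul_eq_mul]
          ring
end
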